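/- The equation g(x) = 0, where g(x) = ln(1+x) - 3 + 3/(1+x), has a unique solution C_th in the open interval (0,∞); moreover C_th > 2, g(x) < 0 for all 0 < x < C_th, and g(x) > 0 for all x > C_th. -/

import Mathlib

/-- `g x = ln (1 + x) - 3 + 3 / (1 + x)`. -/
noncomputable def g (x : ℝ) : ℝ := Real.log (1 + x) - 3 + 3 / (1 + x)

lemma g_hasDerivAt (x : ℝ) (hx : 0 ≤ x) : HasDerivAt g ((x - 2) / (1 + x) ^ 2) x := by
  have h1 : (1 + x) ≠ 0 := by positivity
  have h2 : HasDerivAt (fun y : ℝ => 1 + y) 1 x := (hasDerivAt_id x).const_add 1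
  have h3 := ((h2.log h1).sub_const 3).add ((hasDerivAt_const x (3 : ℝ)).div h2 h1)
  refine HasDerivAt.congr_deriv (f := g) h3 ?_
  field_simp
  ring

lemma g_contOn : ContinuousOn g (Set.Ici 0) := fun x hx =>
  (g_hasDerivAt x hx).continuousAt.continuousWithinAt

lemma g_anti : StrictAntiOn g (Set.Icc 0 2) := by
  apply strictAntiOn_of_deriv_neg (convex_Icc 0 2) (g_contOn.mono Set.Icc_subset_Ici_self)
  intro x hx
  rw [interior_Icc] at hx
  rw [(g_hasDerivAt x hx.1.le).deriv]
  have := hx.1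
  exact div_neg_of_neg_of_pos (by linarith [hx.2]) (by positivity)

lemma g_mono : StrictMonoOn g (Set.Ici 2) := by
  apply strictMonoOn_of_deriv_pos (convex_Ici 2)
    (g_contOn.mono (Set.Ici_subset_Ici.2 (by norm_num)))
  intro x hx
  rw [interior_Ici] at hx
  have hx : 2 < x := hx
  rw [(g_hasDerivAt x (by linarith)).deriv]
  exact div_pos (by linarith) (by positivity)

/-- The equation `g x = 0` has a unique solution `C_th` in `(0, ∞)`; moreover `C_th > 2`,
`g x < 0` for all `0 < x < C_th`, and `g x > 0` for all `x > C_th`. -/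
theorem stmt_2 :
    ∃ Cth : ℝ, 0 < Cth ∧ g Cth = 0 ∧ (∀ x : ℝ, 0 < x → g x = 0 → x = Cth) ∧
      2 < Cth ∧ (∀ x : ℝ, 0 < x → x < Cth → g x < 0) ∧ (∀ x : ℝ, Cth < x → 0 < g x) := by
  have h0 : g 0 = 0 := by simp [g]
  have hneg : ∀ x : ℝ, 0 < x → x ≤ 2 → g x < 0 := fun x h1 h2 => by
    have := g_anti (show (0 : ℝ) ∈ Set.Icc 0 2 by simp) ⟨h1.le, h2⟩ h1
    linarith
  have hE : 0 < g (Real.exp 3 - 1) := by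
    simp only [g, add_sub_cancel, Real.log_exp]
    have := Real.exp_pos 3
    have : 0 < 3 / Real.exp 3 := by positivity
    linarith
  have hE2 : (2 : ℝ) ≤ Real.exp 3 - 1 := by
    have := Real.add_one_le_exp (3 : ℝ)
    linarith
  obtain ⟨c, hc, hgc⟩ := intermediate_value_Icc hE2
    (g_contOn.mono (fun x hx => show (0 : ℝ) ≤ x by linarith [hx.1]))
    (show (0 : ℝ) ∈ Set.Icc _ _ from ⟨(hneg 2 (by norm_num) le_rfl).le, hE.le⟩)
  have hc2 : 2 < c := by
    rcases hc.1.lt_or_eq with h | h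
    · exact h
    · have := hneg 2 (by norm_num) le_rfl
      rw [h] at this
      linarith
  have hlow : ∀ x : ℝ, 0 < x → x < c → g x < 0 := fun x h1 h2 => by
    rcases le_total x 2 with h | h
    · exact hneg x h1 h
    · have := g_mono h hc2.le h2
      linarith
  have hhigh : ∀ x : ℝ, c < x → 0 < g x := fun x h => by
    have := g_mono hc2.le (hc2.trans h).le h
    linarith
  refine ⟨c, by linarith, hgc, fun x hx hgx => ?_, hc2, hlow, hhigh⟩
  rcases lt_trichotomy x c with h | h | h
  · have := hlow x hx h
    linarith
  · exact h
  · have := hhigh x h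
    linarith
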